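/- Let π and ν be two MALL⁻ proofs of the same one-sided sequent Γ. Then π and ν are equivalent (i.e., 𝒮(π) = 𝒮(ν)) if and only if their BDT slicings are equivalent, i.e., B(π) ∼ B(ν). -/

import Mathlib

/-- Formulas of (η-expanded) MALL⁻: atoms `pos a`, negated atoms `neg a`, and the binary
connectives `⊗` (`tens`), `⅋` (`parr`), `⊕` (`plus`) and `&` (`wth`, carrying a
Boolean-variable label). -/
inductive MFormula : Type
  | pos : ℕ → MFormula
  | neg : ℕ → MFormula
  | tens : MFormula → MFormula → MFormula
  | parr : MFormula → MFormula → MFormula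
  | plus : MFormula → MFormula → MFormula
  | wth : ℕ → MFormula → MFormula → MFormula
deriving DecidableEq

namespace MFormula

/-- Number of atom occurrences of a formula. -/
def size : MFormula → ℕ
  | pos _ => 1
  | neg _ => 1
  | tens A B => A.size + B.size
  | parr A B => A.size + B.size
  | plus A B => A.size + B.size
  | wth _ A B => A.size + B.size

/-- Labels of the `&` occurrences of a formula. -/
def labels : MFormula → List ℕ
  | pos _ => []
  | neg _ => []
  | tens A B => A.labels ++ B.labels
  | parr A B => A.labels ++ B.labels
  | plus A B => A.labels ++ B.labels
  | wth x A B => x :: (A.labels ++ B.labels)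

end MFormula

/-- Number of atom occurrences of a one-sided sequent. -/
def mcsz (Γ : List MFormula) : ℕ := (Γ.map MFormula.size).sum

/-- Labels of all `&` occurrences of a one-sided sequent. -/
def mseqLabels (Γ : List MFormula) : List ℕ := (Γ.map MFormula.labels).flatten

/-- Cut-free, η-expanded one-sided sequent calculus proofs of MALL⁻. -/
inductive MProof : List MFormula → Type
  | ax (a : ℕ) : MProof [.neg a, .pos a]
  | parr {Γ : List MFormula} {A B : MFormula} :
      MProof (Γ ++ [A, B]) → MProof (Γ ++ [.parr A B])
  | tens {Γ Δ : List MFormula} {A B : MFormula} :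
      MProof (Γ ++ [A]) → MProof (Δ ++ [B]) → MProof ((Γ ++ Δ) ++ [.tens A B])
  | ex (Γ₁ Γ₂ Γ₃ : List MFormula) (A B : MFormula) :
      MProof (Γ₁ ++ A :: (Γ₂ ++ B :: Γ₃)) → MProof (Γ₁ ++ B :: (Γ₂ ++ A :: Γ₃))
  | plus1 {Γ : List MFormula} {A B : MFormula} :
      MProof (Γ ++ [A]) → MProof (Γ ++ [.plus A B])
  | plus2 {Γ : List MFormula} {A B : MFormula} :
      MProof (Γ ++ [B]) → MProof (Γ ++ [.plus A B])
  | wth (x : ℕ) {Γ : List MFormula} {A B : MFormula} :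
      MProof (Γ ++ [A]) → MProof (Γ ++ [B]) → MProof (Γ ++ [.wth x A B])

/-- Atom occurrences of a sequent `Γ` are identified with positions in its
left-to-right flattening; a slice is a finite set of unordered pairs of positions. -/
abbrev MSlice := Finset (Sym2 ℕ)

/-- Reindexing the atom occurrences of a slice along a map of positions. -/
def MSlice.reindex (f : ℕ → ℕ) (l : MSlice) : MSlice := l.image (Sym2.map f)

/-- Position reindex for the exchange rule: maps the positions of the layout
`[a-block][p-block][b-block][q-block]rest` to those of `[a-block][q-block][b-block][p-block]rest`. -/
def mswapMap (a p b q : ℕ) (i : ℕ) : ℕ :=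
  if i < a then i
  else if i < a + p then i + q + b
  else if i < a + p + b then i - p + q
  else if i < a + p + b + q then i - p - b
  else i

/-- The slicing 𝒮(π) of a MALL⁻ proof. -/
def MProof.slicing : {Γ : List MFormula} → MProof Γ → Finset MSlice
  | _, .ax _ => {({s(0, 1)} : MSlice)}
  | _, .parr p => p.slicing
  | _, @MProof.tens Γ Δ A _ p q =>
      Finset.image₂
        (fun l m =>
          MSlice.reindex (fun i => if i < mcsz Γ then i else i + mcsz Δ) l ∪
          MSlice.reindex (fun i => if i < mcsz Δ then i + mcsz Γ else i + (mcsz Γ + A.size)) m)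
        p.slicing q.slicing
  | _, @MProof.ex Γ₁ Γ₂ _ A B p =>
      p.slicing.image (MSlice.reindex (mswapMap (mcsz Γ₁) A.size (mcsz Γ₂) B.size))
  | _, .plus1 p => p.slicing
  | _, @MProof.plus2 Γ A _ p =>
      p.slicing.image (MSlice.reindex (fun i => if i < mcsz Γ then i else i + A.size))
  | _, @MProof.wth _ Γ A B p q =>
      p.slicing.image (MSlice.reindex (fun i => if i < mcsz Γ + A.size then i else i + B.size))
      ∪ q.slicing.image (MSlice.reindex (fun i => if i < mcsz Γ then i else i + A.size))

/-- Binary decision trees. -/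
inductive BDT : Type
  | leaf : Bool → BDT
  | node : ℕ → BDT → BDT → BDT
deriving DecidableEq

namespace BDT

/-- Evaluation: go left when the variable is `false` (0), right when `true` (1). -/
def eval (v : ℕ → Bool) : BDT → Bool
  | leaf b => b
  | node x l r => if v x then r.eval v else l.eval v

/-- Two BDTs are equivalent when they compute the same Boolean function. -/
def Equiv (φ ψ : BDT) : Prop := ∀ v : ℕ → Bool, φ.eval v = ψ.eval v

end BDT

/-- The BDT slicing B(π) of a MALL⁻ proof, as a (symmetric) function of two atom
positions of the conclusion sequent; it is `0` outside pairs of atoms of the sequent. -/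
def MProof.bdt : {Γ : List MFormula} → MProof Γ → ℕ → ℕ → BDT
  | _, .ax _, i, j =>
      if (i = 0 ∧ j = 1) ∨ (i = 1 ∧ j = 0) then .leaf true else .leaf false
  | _, .parr p, i, j => p.bdt i j
  | _, @MProof.tens Γ Δ A B p q, i, j =>
      if (i < mcsz Γ ∨ (mcsz Γ + mcsz Δ ≤ i ∧ i < mcsz Γ + mcsz Δ + A.size)) ∧
         (j < mcsz Γ ∨ (mcsz Γ + mcsz Δ ≤ j ∧ j < mcsz Γ + mcsz Δ + A.size)) then
        p.bdt (if i < mcsz Γ then i else i - mcsz Δ) (if j < mcsz Γ then j else j - mcsz Δ)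
      else if ((mcsz Γ ≤ i ∧ i < mcsz Γ + mcsz Δ) ∨
                (mcsz Γ + mcsz Δ + A.size ≤ i ∧ i < mcsz Γ + mcsz Δ + A.size + B.size)) ∧
              ((mcsz Γ ≤ j ∧ j < mcsz Γ + mcsz Δ) ∨
                (mcsz Γ + mcsz Δ + A.size ≤ j ∧ j < mcsz Γ + mcsz Δ + A.size + B.size)) then
        q.bdt (if i < mcsz Γ + mcsz Δ then i - mcsz Γ else i - (mcsz Γ + A.size))
              (if j < mcsz Γ + mcsz Δ then j - mcsz Γ else j - (mcsz Γ + A.size))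
      else .leaf false
  | _, @MProof.ex Γ₁ Γ₂ _ A B p, i, j =>
      p.bdt (mswapMap (mcsz Γ₁) B.size (mcsz Γ₂) A.size i)
            (mswapMap (mcsz Γ₁) B.size (mcsz Γ₂) A.size j)
  | _, @MProof.plus1 Γ A _ p, i, j =>
      if i < mcsz Γ + A.size ∧ j < mcsz Γ + A.size then p.bdt i j else .leaf false
  | _, @MProof.plus2 Γ A _ p, i, j =>
      if (i < mcsz Γ ∨ mcsz Γ + A.size ≤ i) ∧ (j < mcsz Γ ∨ mcsz Γ + A.size ≤ j) then
        p.bdt (if i < mcsz Γ then i else i - A.size) (if j < mcsz Γ then j else j - A.size)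
      else .leaf false
  | _, @MProof.wth x Γ A B p q, i, j =>
      if ((mcsz Γ ≤ i ∧ i < mcsz Γ + A.size) ∧
            (mcsz Γ + A.size ≤ j ∧ j < mcsz Γ + A.size + B.size)) ∨
         ((mcsz Γ ≤ j ∧ j < mcsz Γ + A.size) ∧
            (mcsz Γ + A.size ≤ i ∧ i < mcsz Γ + A.size + B.size)) then
        .leaf false
      else if (mcsz Γ ≤ i ∧ i < mcsz Γ + A.size) ∨ (mcsz Γ ≤ j ∧ j < mcsz Γ + A.size) then
        .node x (p.bdt (if i < mcsz Γ + A.size then i else i - B.size)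
                       (if j < mcsz Γ + A.size then j else j - B.size)) (.leaf false)
      else if (mcsz Γ + A.size ≤ i ∧ i < mcsz Γ + A.size + B.size) ∨
              (mcsz Γ + A.size ≤ j ∧ j < mcsz Γ + A.size + B.size) then
        .node x (.leaf false) (q.bdt (if i < mcsz Γ then i else i - A.size)
                                     (if j < mcsz Γ then j else j - A.size))
      else
        .node x (p.bdt (if i < mcsz Γ + A.size then i else i - B.size)
                       (if j < mcsz Γ + A.size then j else j - B.size))
                (q.bdt (if i < mcsz Γ then i else i - A.size)
                       (if j < mcsz Γ then j else j - A.size))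

/-- Smaller element of an unordered pair of positions. -/
def pmin (p : Sym2 ℕ) : ℕ := Sym2.lift ⟨fun a b => min a b, fun a b => min_comm a b⟩ p
/-- Larger element of an unordered pair of positions. -/
def pmax (p : Sym2 ℕ) : ℕ := Sym2.lift ⟨fun a b => max a b, fun a b => max_comm a b⟩ p

/-- The BDT slicing B(π) at an unordered pair of atom positions. -/
def MProof.bdtAt {Γ : List MFormula} (π : MProof Γ) (p : Sym2 ℕ) : BDT :=
  π.bdt (pmin p) (pmax p)

open MFormula

namespace MSlice

/-- The atom positions occurring in a slice. -/
def Touches (l : MSlice) (i : ℕ) : Prop := ∃ p ∈ l, i ∈ p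

theorem mk_mem_reindex {f : ℕ → ℕ} {l : MSlice} {i j : ℕ} :
    s(i, j) ∈ l.reindex f ↔ ∃ a b, s(a, b) ∈ l ∧ f a = i ∧ f b = j := by
  simp only [reindex, Finset.mem_image]
  constructor
  · rintro ⟨p, hp, h⟩
    induction p using Sym2.ind with
    | _ a b =>
      rw [Sym2.map_mk, Sym2.eq_iff] at h
      rcases h with h | h
      · exact ⟨a, b, hp, h⟩
      · exact ⟨b, a, Sym2.eq_swap ▸ hp, h.2, h.1⟩
  · rintro ⟨a, b, hp, rfl, rfl⟩
    exact ⟨_, hp, rfl⟩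

theorem touches_iff {l : MSlice} {i : ℕ} : l.Touches i ↔ ∃ j, s(i, j) ∈ l := by
  constructor
  · rintro ⟨p, hp, j, rfl⟩
    exact ⟨j, hp⟩
  · rintro ⟨j, hj⟩
    exact ⟨_, hj, Sym2.mem_mk_left i j⟩

theorem touches_reindex {f : ℕ → ℕ} {l : MSlice} {i : ℕ} :
    (l.reindex f).Touches i ↔ ∃ a, l.Touches a ∧ f a = i := by
  simp only [touches_iff, mk_mem_reindex]
  constructor
  · rintro ⟨_, a, b, h, rfl, rfl⟩
    exact ⟨a, ⟨b, h⟩, rfl⟩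
  · rintro ⟨a, ⟨b, h⟩, rfl⟩
    exact ⟨f b, a, b, h, rfl, rfl⟩

theorem touches_union {l m : MSlice} {i : ℕ} :
    Touches (l ∪ m) i ↔ l.Touches i ∨ m.Touches i := by
  simp [touches_iff, exists_or]

theorem mk_mem_reindex_iff_of_leftInverse {f g : ℕ → ℕ} {l : MSlice} {C : ℕ → Prop}
    (hf : ∀ a, l.Touches a → C (f a) ∧ g (f a) = a) (hg : ∀ i, C i → f (g i) = i) (i j : ℕ) :
    s(i, j) ∈ l.reindex f ↔ (C i ∧ C j) ∧ s(g i, g j) ∈ l := by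
  rw [mk_mem_reindex]
  constructor
  · rintro ⟨a, b, h, rfl, rfl⟩
    have ha := hf a ⟨_, h, Sym2.mem_mk_left a b⟩
    have hb := hf b ⟨_, h, Sym2.mem_mk_right a b⟩
    exact ⟨⟨ha.1, hb.1⟩, by rwa [ha.2, hb.2]⟩
  · rintro ⟨⟨hi, hj⟩, h⟩
    exact ⟨_, _, h, hg i hi, hg j hj⟩

end MSlice

theorem mcsz_nil : mcsz [] = 0 := rfl

theorem mcsz_cons (A : MFormula) (Γ : List MFormula) : mcsz (A :: Γ) = A.size + mcsz Γ := by
  simp [mcsz]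

theorem mcsz_append (Γ Δ : List MFormula) : mcsz (Γ ++ Δ) = mcsz Γ + mcsz Δ := by
  simp [mcsz]

theorem mseqLabels_nil : mseqLabels [] = [] := rfl

theorem mseqLabels_cons (A : MFormula) (Γ : List MFormula) :
    mseqLabels (A :: Γ) = A.labels ++ mseqLabels Γ := by
  simp [mseqLabels]

theorem mseqLabels_append (Γ Δ : List MFormula) :
    mseqLabels (Γ ++ Δ) = mseqLabels Γ ++ mseqLabels Δ := by
  simp [mseqLabels]

/-- The atom positions of a formula that survive the `&`-choices made by a valuation. -/
def MFormula.Alive (v : ℕ → Bool) : MFormula → ℕ → Prop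
  | pos _, _ => True
  | neg _, _ => True
  | tens A B, i => if i < A.size then A.Alive v i else B.Alive v (i - A.size)
  | parr A B, i => if i < A.size then A.Alive v i else B.Alive v (i - A.size)
  | plus A B, i => if i < A.size then A.Alive v i else B.Alive v (i - A.size)
  | wth x A B, i =>
      if i < A.size then v x = false ∧ A.Alive v i else v x = true ∧ B.Alive v (i - A.size)

/-- The atom positions of a sequent that survive the `&`-choices made by a valuation. -/
def SeqAlive (v : ℕ → Bool) : List MFormula → ℕ → Prop
  | [], _ => True
  | A :: Γ, i => if i < A.size then A.Alive v i else SeqAlive v Γ (i - A.size)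

theorem seqAlive_append (v : ℕ → Bool) (Γ Δ : List MFormula) (i : ℕ) :
    SeqAlive v (Γ ++ Δ) i ↔
      if i < mcsz Γ then SeqAlive v Γ i else SeqAlive v Δ (i - mcsz Γ) := by
  induction Γ generalizing i with
  | nil => simp [mcsz_nil]
  | cons A Γ ih =>
    simp only [List.cons_append, SeqAlive, mcsz_cons, ih]
    split_ifs <;> first | rfl | omega | (rw [Nat.sub_sub])

section SeqAlive

variable (v : ℕ → Bool) (Γ Δ : List MFormula) (A B : MFormula)

theorem seqAlive_parr {i : ℕ} (hi : i < mcsz (Γ ++ [A, B])) :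
    SeqAlive v (Γ ++ [.parr A B]) i ↔ SeqAlive v (Γ ++ [A, B]) i := by
  simp only [mcsz_append, mcsz_cons, mcsz_nil] at hi
  simp only [seqAlive_append, SeqAlive, Alive, size]
  by_cases h : i < mcsz Γ
  · simp only [h, if_true]
  · simp only [h, if_false, show i - mcsz Γ < A.size + B.size by omega, if_true]
    by_cases hA : i - mcsz Γ < A.size
    · simp only [hA, if_true]
    · simp only [hA, if_false, show i - mcsz Γ - A.size < B.size by omega, if_true]

theorem seqAlive_tens_left {i : ℕ} (hi : i < mcsz (Γ ++ [A])) :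
    SeqAlive v ((Γ ++ Δ) ++ [.tens A B]) (if i < mcsz Γ then i else i + mcsz Δ) ↔
      SeqAlive v (Γ ++ [A]) i := by
  simp only [mcsz_append, mcsz_cons, mcsz_nil] at hi
  simp only [seqAlive_append, SeqAlive, Alive, size, mcsz_append]
  split_ifs <;> first | rfl | omega | (apply iff_of_eq; congr 1; omega)

theorem seqAlive_tens_right {i : ℕ} (hi : i < mcsz (Δ ++ [B])) :
    SeqAlive v ((Γ ++ Δ) ++ [.tens A B])
        (if i < mcsz Δ then i + mcsz Γ else i + (mcsz Γ + A.size)) ↔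
      SeqAlive v (Δ ++ [B]) i := by
  simp only [mcsz_append, mcsz_cons, mcsz_nil] at hi
  simp only [seqAlive_append, SeqAlive, Alive, size, mcsz_append]
  split_ifs <;> first | rfl | omega | (apply iff_of_eq; congr 1; omega)

theorem seqAlive_ex (Γ₁ Γ₂ Γ₃ : List MFormula) (i : ℕ) :
    SeqAlive v (Γ₁ ++ B :: (Γ₂ ++ A :: Γ₃))
        (mswapMap (mcsz Γ₁) A.size (mcsz Γ₂) B.size i) ↔
      SeqAlive v (Γ₁ ++ A :: (Γ₂ ++ B :: Γ₃)) i := by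
  simp only [seqAlive_append, SeqAlive, mswapMap]
  split_ifs <;> first | rfl | omega | (apply iff_of_eq; congr 1; omega)

theorem seqAlive_plus_left {i : ℕ} (hi : i < mcsz (Γ ++ [A])) :
    SeqAlive v (Γ ++ [.plus A B]) i ↔ SeqAlive v (Γ ++ [A]) i := by
  simp only [mcsz_append, mcsz_cons, mcsz_nil] at hi
  simp only [seqAlive_append, SeqAlive, Alive, size]
  by_cases h : i < mcsz Γ
  · simp only [h, if_true]
  · simp only [h, if_false, show i - mcsz Γ < A.size by omega,
      show i - mcsz Γ < A.size + B.size by omega, if_true]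

theorem seqAlive_plus_right {i : ℕ} (hi : i < mcsz (Γ ++ [B])) :
    SeqAlive v (Γ ++ [.plus A B]) (if i < mcsz Γ then i else i + A.size) ↔
      SeqAlive v (Γ ++ [B]) i := by
  simp only [mcsz_append, mcsz_cons, mcsz_nil] at hi
  simp only [seqAlive_append, SeqAlive, Alive, size]
  split_ifs <;> first | rfl | omega | (apply iff_of_eq; congr 1; omega)

theorem seqAlive_wth_left (x : ℕ) {i : ℕ} (hi : i < mcsz (Γ ++ [A])) :
    SeqAlive v (Γ ++ [.wth x A B]) (if i < mcsz Γ + A.size then i else i + B.size) ↔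
      (mcsz Γ ≤ i → v x = false) ∧ SeqAlive v (Γ ++ [A]) i := by
  simp only [mcsz_append, mcsz_cons, mcsz_nil] at hi
  rw [if_pos (by omega)]
  simp only [seqAlive_append, SeqAlive, Alive, size]
  by_cases h : i < mcsz Γ
  · simp [h, Nat.not_le.2 h]
  · simp [h, Nat.not_lt.1 h, show i - mcsz Γ < A.size by omega,
      show i - mcsz Γ < A.size + B.size by omega]

theorem seqAlive_wth_right (x : ℕ) {i : ℕ} (hi : i < mcsz (Γ ++ [B])) :
    SeqAlive v (Γ ++ [.wth x A B]) (if i < mcsz Γ then i else i + A.size) ↔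
      (mcsz Γ ≤ i → v x = true) ∧ SeqAlive v (Γ ++ [B]) i := by
  simp only [mcsz_append, mcsz_cons, mcsz_nil] at hi
  simp only [seqAlive_append, SeqAlive, Alive, size]
  by_cases h : i < mcsz Γ
  · simp [h, Nat.not_le.2 h]
  · simp [h, Nat.not_lt.1 h, show ¬ i + A.size < mcsz Γ by omega,
      show ¬ i + A.size - mcsz Γ < A.size by omega, show i - mcsz Γ < B.size by omega,
      show i + A.size - mcsz Γ < A.size + B.size by omega,
      show i + A.size - mcsz Γ - A.size = i - mcsz Γ by omega]

end SeqAlive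

/-- A set of positions meets every formula of a sequent. -/
def MeetsAll : List MFormula → (ℕ → Prop) → Prop
  | [], _ => True
  | A :: Γ, T => (∃ i < A.size, T i) ∧ MeetsAll Γ (fun i => T (A.size + i))

theorem meetsAll_append (Γ Δ : List MFormula) (T : ℕ → Prop) :
    MeetsAll (Γ ++ Δ) T ↔ MeetsAll Γ T ∧ MeetsAll Δ (fun i => T (mcsz Γ + i)) := by
  induction Γ generalizing T with
  | nil => simp [MeetsAll, mcsz_nil]
  | cons A Γ ih => simp only [List.cons_append, MeetsAll, mcsz_cons, ih, and_assoc, add_assoc]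

theorem MeetsAll.mono {Γ : List MFormula} {T T' : ℕ → Prop} (h : MeetsAll Γ T)
    (hT : ∀ i < mcsz Γ, T i → T' i) : MeetsAll Γ T' := by
  induction Γ generalizing T T' with
  | nil => trivial
  | cons A Γ ih =>
    rw [mcsz_cons] at hT
    obtain ⟨⟨i, hi, hTi⟩, h⟩ := h
    exact ⟨⟨i, hi, hT i (by omega) hTi⟩, ih h fun j hj => hT _ (by omega)⟩

namespace MProof

variable {Γ : List MFormula}

/-- The slice of a proof selected by a valuation. -/
def slice (v : ℕ → Bool) : {Γ : List MFormula} → MProof Γ → MSlice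
  | _, .ax _ => {s(0, 1)}
  | _, .parr p => p.slice v
  | _, @MProof.tens Γ Δ A _ p q =>
      MSlice.reindex (fun i => if i < mcsz Γ then i else i + mcsz Δ) (p.slice v) ∪
      MSlice.reindex (fun i => if i < mcsz Δ then i + mcsz Γ else i + (mcsz Γ + A.size))
        (q.slice v)
  | _, @MProof.ex Γ₁ Γ₂ _ A B p =>
      (p.slice v).reindex (mswapMap (mcsz Γ₁) A.size (mcsz Γ₂) B.size)
  | _, .plus1 p => p.slice v
  | _, @MProof.plus2 Γ A _ p =>
      (p.slice v).reindex (fun i => if i < mcsz Γ then i else i + A.size)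
  | _, @MProof.wth x Γ A B p q =>
      if v x then (q.slice v).reindex (fun i => if i < mcsz Γ then i else i + A.size)
      else (p.slice v).reindex (fun i => if i < mcsz Γ + A.size then i else i + B.size)

theorem slice_mem_slicing (v : ℕ → Bool) (π : MProof Γ) : π.slice v ∈ π.slicing := by
  induction π with
  | ax => simp [slice, slicing]
  | parr p ih => exact ih
  | tens p q ihp ihq => exact Finset.mem_image₂_of_mem ihp ihq
  | ex _ _ _ _ _ p ih => exact Finset.mem_image_of_mem _ ih
  | plus1 p ih => exact ih
  | plus2 p ih => exact Finset.mem_image_of_mem _ ih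
  | wth x p q ihp ihq =>
    simp only [slice, slicing]
    split_ifs
    · exact Finset.mem_union_right _ (Finset.mem_image_of_mem _ ihq)
    · exact Finset.mem_union_left _ (Finset.mem_image_of_mem _ ihp)

theorem lt_of_touches (π : MProof Γ) {l : MSlice} (hl : l ∈ π.slicing) {i : ℕ}
    (hi : l.Touches i) : i < mcsz Γ := by
  induction π generalizing l i with
  | ax a =>
    obtain rfl := Finset.mem_singleton.1 hl
    obtain ⟨p, hp, hi⟩ := hi
    obtain rfl := Finset.mem_singleton.1 hp
    simp only [mcsz_cons, mcsz_nil, size]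
    rcases Sym2.mem_iff.1 hi with rfl | rfl <;> omega
  | parr p ih =>
    have := ih hl hi
    simp only [mcsz_append, mcsz_cons, mcsz_nil, size] at this ⊢
    omega
  | tens p q ihp ihq =>
    obtain ⟨l, hl₁, m, hm, rfl⟩ := Finset.mem_image₂.1 hl
    simp only [MSlice.touches_union, MSlice.touches_reindex] at hi
    simp only [mcsz_append, mcsz_cons, mcsz_nil, size] at ihp ihq ⊢
    rcases hi with ⟨a, ha, rfl⟩ | ⟨a, ha, rfl⟩
    · have := ihp hl₁ ha
      split_ifs <;> omega
    · have := ihq hm ha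
      split_ifs <;> omega
  | ex _ _ _ _ _ p ih =>
    obtain ⟨l, hl₁, rfl⟩ := Finset.mem_image.1 hl
    obtain ⟨a, ha, rfl⟩ := MSlice.touches_reindex.1 hi
    have := ih hl₁ ha
    simp only [mcsz_append, mcsz_cons, mswapMap] at this ⊢
    split_ifs <;> omega
  | plus1 p ih =>
    have := ih hl hi
    simp only [mcsz_append, mcsz_cons, mcsz_nil, size] at this ⊢
    omega
  | plus2 p ih =>
    obtain ⟨l, hl₁, rfl⟩ := Finset.mem_image.1 hl
    obtain ⟨a, ha, rfl⟩ := MSlice.touches_reindex.1 hi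
    have := ih hl₁ ha
    simp only [mcsz_append, mcsz_cons, mcsz_nil, size] at this ⊢
    split_ifs <;> omega
  | wth x p q ihp ihq =>
    simp only [mcsz_append, mcsz_cons, mcsz_nil, size] at ihp ihq ⊢
    rcases Finset.mem_union.1 hl with hl | hl
    · obtain ⟨l, hl₁, rfl⟩ := Finset.mem_image.1 hl
      obtain ⟨a, ha, rfl⟩ := MSlice.touches_reindex.1 hi
      have := ihp hl₁ ha
      split_ifs <;> omega
    · obtain ⟨l, hl₁, rfl⟩ := Finset.mem_image.1 hl
      obtain ⟨a, ha, rfl⟩ := MSlice.touches_reindex.1 hi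
      have := ihq hl₁ ha
      split_ifs <;> omega

theorem meetsAll_of_mem_slicing (π : MProof Γ) {l : MSlice} (hl : l ∈ π.slicing) :
    MeetsAll Γ l.Touches := by
  induction π generalizing l with
  | ax a =>
    obtain rfl := Finset.mem_singleton.1 hl
    exact ⟨⟨0, Nat.one_pos, _, Finset.mem_singleton_self _, by simp⟩,
      ⟨0, Nat.one_pos, _, Finset.mem_singleton_self _, by simp [size]⟩, trivial⟩
  | parr p ih =>
    have := ih hl
    simp only [meetsAll_append, MeetsAll] at this ⊢
    obtain ⟨h, ⟨i, hi, hT⟩, -⟩ := this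
    exact ⟨h, ⟨i, by simp only [size]; omega, hT⟩, trivial⟩
  | @tens Γ Δ A B p q ihp ihq =>
    obtain ⟨l, hl₁, m, hm, rfl⟩ := Finset.mem_image₂.1 hl
    obtain ⟨hΓ, ⟨i, hi, hT⟩, -⟩ := (meetsAll_append _ _ _).1 (ihp hl₁)
    obtain ⟨hΔ, -⟩ := (meetsAll_append _ _ _).1 (ihq hm)
    simp only [meetsAll_append, MeetsAll, MSlice.touches_union, MSlice.touches_reindex, mcsz_append]
    refine ⟨⟨hΓ.mono fun k hk hT =>
      MSlice.touches_union.2 (.inl (MSlice.touches_reindex.2 ⟨k, hT, if_pos hk⟩)),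
      hΔ.mono fun k hk hT => .inr ⟨k, hT, ?_⟩⟩, ⟨i, ?_, .inl ⟨_, hT, ?_⟩⟩, trivial⟩
    · rw [if_pos hk, add_comm]
    · simp only [size]; omega
    · split_ifs <;> omega
  | ex Γ₁ Γ₂ Γ₃ A B p ih =>
    obtain ⟨l, hl₁, rfl⟩ := Finset.mem_image.1 hl
    have := ih hl₁
    simp only [meetsAll_append, MeetsAll, MSlice.touches_reindex] at this ⊢
    obtain ⟨h₁, ⟨i, hi, hA⟩, h₂, ⟨j, hj, hB⟩, h₃⟩ := this
    refine ⟨h₁.mono fun k hk hT => MSlice.touches_reindex.2 ⟨_, hT, ?_⟩, ⟨j, hj, _, hB, ?_⟩,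
      h₂.mono fun k hk hT => ⟨_, hT, ?_⟩, ⟨i, hi, _, hA, ?_⟩,
      h₃.mono fun k hk hT => ⟨_, hT, ?_⟩⟩ <;>
    · simp only [mswapMap]
      split_ifs <;> omega
  | plus1 p ih =>
    have := ih hl
    simp only [meetsAll_append, MeetsAll] at this ⊢
    obtain ⟨h, ⟨i, hi, hT⟩, -⟩ := this
    exact ⟨h, ⟨i, by simp only [size]; omega, hT⟩, trivial⟩
  | @plus2 Γ A B p ih =>
    obtain ⟨l, hl₁, rfl⟩ := Finset.mem_image.1 hl
    obtain ⟨hΓ, ⟨i, hi, hT⟩, -⟩ := (meetsAll_append _ _ _).1 (ih hl₁)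
    simp only [meetsAll_append, MeetsAll, MSlice.touches_reindex]
    refine ⟨hΓ.mono fun k hk hT => MSlice.touches_reindex.2 ⟨k, hT, if_pos hk⟩,
      ⟨i + A.size, ?_, _, hT, ?_⟩, trivial⟩
    · simp only [size]; omega
    · split_ifs <;> omega
  | @wth x Γ A B p q ihp ihq =>
    rcases Finset.mem_union.1 hl with hl | hl
    · obtain ⟨l, hl₁, rfl⟩ := Finset.mem_image.1 hl
      obtain ⟨hΓ, ⟨i, hi, hT⟩, -⟩ := (meetsAll_append _ _ _).1 (ihp hl₁)
      simp only [meetsAll_append, MeetsAll, MSlice.touches_reindex]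
      refine ⟨hΓ.mono fun k hk hT =>
        MSlice.touches_reindex.2 ⟨k, hT, if_pos (by omega)⟩, ⟨i, ?_, _, hT, ?_⟩, trivial⟩
      · simp only [size]; omega
      · split_ifs <;> omega
    · obtain ⟨l, hl₁, rfl⟩ := Finset.mem_image.1 hl
      obtain ⟨hΓ, ⟨i, hi, hT⟩, -⟩ := (meetsAll_append _ _ _).1 (ihq hl₁)
      simp only [meetsAll_append, MeetsAll, MSlice.touches_reindex]
      refine ⟨hΓ.mono fun k hk hT => MSlice.touches_reindex.2 ⟨k, hT, if_pos hk⟩,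
      ⟨i + A.size, ?_, _, hT, ?_⟩, trivial⟩
      · simp only [size]; omega
      · split_ifs <;> omega

theorem mk_mem_slice_iff (v : ℕ → Bool) (π : MProof Γ) (i j : ℕ) :
    s(i, j) ∈ π.slice v ↔ (π.bdt i j).eval v = true := by
  induction π generalizing i j with
  | ax a =>
    simp only [slice, bdt, Finset.mem_singleton, Sym2.eq_iff]
    split_ifs with h <;> simp [BDT.eval, h]
  | parr p ih => exact ih i j
  | @tens Γ Δ A B p q ihp ihq =>
    have hp := fun a => p.lt_of_touches (p.slice_mem_slicing v) (i := a)
    have hq := fun a => q.lt_of_touches (q.slice_mem_slicing v) (i := a)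
    simp only [mcsz_append, mcsz_cons, mcsz_nil] at hp hq
    rw [slice, Finset.mem_union,
      MSlice.mk_mem_reindex_iff_of_leftInverse (l := p.slice v)
        (g := fun i => if i < mcsz Γ then i else i - mcsz Δ)
        (C := fun i => i < mcsz Γ ∨ (mcsz Γ + mcsz Δ ≤ i ∧ i < mcsz Γ + mcsz Δ + A.size)),
      MSlice.mk_mem_reindex_iff_of_leftInverse (l := q.slice v)
        (g := fun i => if i < mcsz Γ + mcsz Δ then i - mcsz Γ else i - (mcsz Γ + A.size))
        (C := fun i => (mcsz Γ ≤ i ∧ i < mcsz Γ + mcsz Δ) ∨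
          (mcsz Γ + mcsz Δ + A.size ≤ i ∧ i < mcsz Γ + mcsz Δ + A.size + B.size)), bdt, ihp, ihq]
    · generalize p.bdt _ _ = P
      generalize q.bdt _ _ = Q
      split_ifs with h₁ h₂
      · exact ⟨fun h => h.elim And.right fun h => by omega, fun h => .inl ⟨h₁, h⟩⟩
      · exact ⟨fun h => h.elim (fun h => absurd h.1 h₁) And.right, fun h => .inr ⟨h₂, h⟩⟩
      · simp only [h₁, h₂, false_and, or_false, BDT.eval, Bool.false_eq_true]
    · intro a ha
      have := hq a ha
      constructor <;> (split_ifs <;> omega)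
    · intro a ha
      split_ifs <;> omega
    · intro a ha
      have := hp a ha
      constructor <;> (split_ifs <;> omega)
    · intro a ha
      split_ifs <;> omega
  | ex Γ₁ Γ₂ Γ₃ A B p ih =>
    rw [slice, MSlice.mk_mem_reindex_iff_of_leftInverse
      (g := mswapMap (mcsz Γ₁) B.size (mcsz Γ₂) A.size) (C := fun _ => True), bdt, ih]
    · simp
    · intro a _
      refine ⟨trivial, ?_⟩
      simp only [mswapMap]
      split_ifs <;> omega
    · intro a _
      simp only [mswapMap]
      split_ifs <;> omega
  | @plus1 Γ A B p ih =>
    have hp := fun a => p.lt_of_touches (p.slice_mem_slicing v) (i := a)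
    simp only [mcsz_append, mcsz_cons, mcsz_nil] at hp
    rw [slice, bdt]
    split_ifs with h
    · exact ih i j
    · simp only [BDT.eval, Bool.false_eq_true, iff_false]
      exact fun hm => h ⟨hp i ⟨_, hm, Sym2.mem_mk_left i j⟩, hp j ⟨_, hm, Sym2.mem_mk_right i j⟩⟩
  | @plus2 Γ A B p ih =>
    rw [slice, MSlice.mk_mem_reindex_iff_of_leftInverse
      (g := fun i => if i < mcsz Γ then i else i - A.size)
      (C := fun i => i < mcsz Γ ∨ mcsz Γ + A.size ≤ i), bdt, ih]
    · generalize p.bdt _ _ = P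
      split_ifs with h <;> simp [h, BDT.eval]
    · intro a _
      constructor <;> (split_ifs <;> omega)
    · intro a ha
      split_ifs <;> omega
  | @wth x Γ A B p q ihp ihq =>
    rw [slice]
    split_ifs with hv
    · rw [MSlice.mk_mem_reindex_iff_of_leftInverse
        (g := fun i => if i < mcsz Γ then i else i - A.size)
        (C := fun i => i < mcsz Γ ∨ mcsz Γ + A.size ≤ i), bdt, ihq]
      · generalize p.bdt _ _ = P
        generalize q.bdt _ _ = Q
        by_cases hE : Q.eval v = true <;> split_ifs <;>
          simp only [BDT.eval, hv, hE, if_true, and_true, and_false, iff_true, iff_false,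
            Bool.false_eq_true] <;> omega
      · intro a _
        constructor <;> (split_ifs <;> omega)
      · intro a ha
        split_ifs <;> omega
    · rw [MSlice.mk_mem_reindex_iff_of_leftInverse
        (g := fun i => if i < mcsz Γ + A.size then i else i - B.size)
        (C := fun i => i < mcsz Γ + A.size ∨ mcsz Γ + A.size + B.size ≤ i), bdt, ihp]
      · generalize p.bdt _ _ = P
        generalize q.bdt _ _ = Q
        by_cases hE : P.eval v = true <;> split_ifs <;>
          simp only [BDT.eval, hv, hE, if_false, and_true, and_false, iff_true, iff_false,
            Bool.false_eq_true] <;> omega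
      · intro a _
        constructor <;> (split_ifs <;> omega)
      · intro a ha
        split_ifs <;> omega

theorem slice_congr (π : MProof Γ) {v w : ℕ → Bool} (h : ∀ x ∈ mseqLabels Γ, v x = w x) :
    π.slice v = π.slice w := by
  induction π with
  | ax => rfl
  | parr p ih | plus1 p ih =>
    exact ih fun x hx => h x (by
      simp only [mseqLabels_append, mseqLabels_cons, mseqLabels_nil, labels, List.mem_append] at hx ⊢
      tauto)
  | ex _ _ _ _ _ p ih | plus2 p ih =>
    rw [slice, slice, ih fun x hx => h x (by
      simp only [mseqLabels_append, mseqLabels_cons, mseqLabels_nil, labels, List.mem_append] at hx ⊢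
      tauto)]
  | tens p q ihp ihq =>
    simp only [mseqLabels_append, mseqLabels_cons, mseqLabels_nil, labels, List.mem_append]
      at h ihp ihq
    rw [slice, slice, ihp fun x hx => h x (by tauto), ihq fun x hx => h x (by tauto)]
  | wth x p q ihp ihq =>
    simp only [mseqLabels_append, mseqLabels_cons, mseqLabels_nil, labels, List.mem_append,
      List.mem_cons] at h ihp ihq
    rw [slice, slice, h x (by tauto), ihp fun x hx => h x (by tauto),
      ihq fun x hx => h x (by tauto)]

theorem exists_slice_eq (hlab : (mseqLabels Γ).Nodup) (π : MProof Γ) {l : MSlice}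
    (hl : l ∈ π.slicing) : ∃ v, π.slice v = l := by
  rw [List.nodup_iff_count_le_one] at hlab
  induction π generalizing l with
  | ax a => exact ⟨fun _ => false, (Finset.mem_singleton.1 hl).symm⟩
  | parr p ih | plus1 p ih =>
    refine ih (fun x => ?_) hl
    have := hlab x
    simp only [mseqLabels_append, mseqLabels_cons, mseqLabels_nil, labels, List.count_append]
      at this ⊢
    omega
  | ex _ _ _ _ _ p ih | plus2 p ih =>
    obtain ⟨l, hl₁, rfl⟩ := Finset.mem_image.1 hl
    obtain ⟨v, rfl⟩ := ih (fun x => by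
      have := hlab x
      simp only [mseqLabels_append, mseqLabels_cons, mseqLabels_nil, labels, List.count_append]
        at this ⊢
      omega) hl₁
    exact ⟨v, rfl⟩
  | @tens Γ Δ A B p q ihp ihq =>
    obtain ⟨l, hl₁, m, hm, rfl⟩ := Finset.mem_image₂.1 hl
    have hcount : ∀ x, List.count x (mseqLabels (Γ ++ [A])) +
        List.count x (mseqLabels (Δ ++ [B])) ≤ 1 := fun x => by
      have := hlab x
      simp only [mseqLabels_append, mseqLabels_cons, mseqLabels_nil, labels, List.count_append,
        List.count_nil] at this ⊢
      omega
    obtain ⟨v, rfl⟩ := ihp (fun x => by have := hcount x; omega) hl₁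
    obtain ⟨w, rfl⟩ := ihq (fun x => by have := hcount x; omega) hm
    refine ⟨fun x => if x ∈ mseqLabels (Γ ++ [A]) then v x else w x, ?_⟩
    rw [slice, p.slice_congr (w := v) fun x hx => if_pos hx,
      q.slice_congr (w := w) fun x hx => if_neg fun hx' => ?_]
    have := hcount x
    rw [← List.count_pos_iff] at hx hx'
    omega
  | @wth x Γ A B p q ihp ihq =>
    have hcount : ∀ y, List.count y (mseqLabels Γ) + List.count y A.labels +
        List.count y B.labels + (if y = x then 1 else 0) ≤ 1 := fun y => by
      have := hlab y
      simp only [mseqLabels_append, mseqLabels_cons, mseqLabels_nil, labels, List.count_append,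
        List.count_cons, List.count_nil, beq_iff_eq, eq_comm (a := x)] at this ⊢
      omega
    simp only [mseqLabels_append, mseqLabels_cons, mseqLabels_nil, List.count_append,
      List.count_nil] at ihp ihq
    have hx := hcount x
    rw [if_pos rfl] at hx
    have hA : x ∉ mseqLabels (Γ ++ [A]) := by
      simp only [← List.count_pos_iff, mseqLabels_append, mseqLabels_cons, mseqLabels_nil,
        List.count_append, List.count_nil]
      omega
    have hB : x ∉ mseqLabels (Γ ++ [B]) := by
      simp only [← List.count_pos_iff, mseqLabels_append, mseqLabels_cons, mseqLabels_nil,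
        List.count_append, List.count_nil]
      omega
    rcases Finset.mem_union.1 hl with hl | hl
    · obtain ⟨l, hl₁, rfl⟩ := Finset.mem_image.1 hl
      obtain ⟨v, rfl⟩ := ihp (fun y => by have := hcount y; omega) hl₁
      refine ⟨Function.update v x false, ?_⟩
      rw [slice, Function.update_self, if_neg Bool.false_ne_true, p.slice_congr (w := v)]
      exact fun y hy => Function.update_of_ne (ne_of_mem_of_not_mem hy hA) _ _
    · obtain ⟨l, hl₁, rfl⟩ := Finset.mem_image.1 hl
      obtain ⟨v, rfl⟩ := ihq (fun y => by have := hcount y; omega) hl₁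
      refine ⟨Function.update v x true, ?_⟩
      rw [slice, Function.update_self, if_pos rfl, q.slice_congr (w := v)]
      exact fun y hy => Function.update_of_ne (ne_of_mem_of_not_mem hy hB) _ _

theorem seqAlive_of_touches_slice (v : ℕ → Bool) (π : MProof Γ) {i : ℕ}
    (hi : (π.slice v).Touches i) : SeqAlive v Γ i := by
  induction π generalizing i with
  | ax a =>
    simp only [SeqAlive, Alive, ite_self]
  | parr p ih =>
    exact (seqAlive_parr _ _ _ _ (p.lt_of_touches (p.slice_mem_slicing v) hi)).2 (ih hi)
  | tens p q ihp ihq =>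
    rcases MSlice.touches_union.1 hi with hi | hi
    · obtain ⟨a, ha, rfl⟩ := MSlice.touches_reindex.1 hi
      exact (seqAlive_tens_left _ _ _ _ _ (p.lt_of_touches (p.slice_mem_slicing v) ha)).2 (ihp ha)
    · obtain ⟨a, ha, rfl⟩ := MSlice.touches_reindex.1 hi
      exact (seqAlive_tens_right _ _ _ _ _ (q.lt_of_touches (q.slice_mem_slicing v) ha)).2 (ihq ha)
  | ex _ _ _ _ _ p ih =>
    obtain ⟨a, ha, rfl⟩ := MSlice.touches_reindex.1 hi
    exact (seqAlive_ex _ _ _ _ _ _ _).2 (ih ha)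
  | plus1 p ih =>
    exact (seqAlive_plus_left _ _ _ _ (p.lt_of_touches (p.slice_mem_slicing v) hi)).2 (ih hi)
  | plus2 p ih =>
    obtain ⟨a, ha, rfl⟩ := MSlice.touches_reindex.1 hi
    exact (seqAlive_plus_right _ _ _ _ (p.lt_of_touches (p.slice_mem_slicing v) ha)).2 (ih ha)
  | wth x p q ihp ihq =>
    rw [slice] at hi
    split_ifs at hi with hv
    · obtain ⟨a, ha, rfl⟩ := MSlice.touches_reindex.1 hi
      exact (seqAlive_wth_right _ _ _ _ _ (q.lt_of_touches (q.slice_mem_slicing v) ha)).2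
        ⟨fun _ => hv, ihq ha⟩
    · obtain ⟨a, ha, rfl⟩ := MSlice.touches_reindex.1 hi
      exact (seqAlive_wth_left _ _ _ _ _ (p.lt_of_touches (p.slice_mem_slicing v) ha)).2
        ⟨fun _ => Bool.eq_false_of_not_eq_true hv, ihp ha⟩

theorem exists_touches_last {A : MFormula} (π : MProof (Γ ++ [A])) {l : MSlice}
    (hl : l ∈ π.slicing) : ∃ i, mcsz Γ ≤ i ∧ l.Touches i := by
  obtain ⟨-, ⟨i, -, hi⟩, -⟩ := (meetsAll_append _ _ _).1 (π.meetsAll_of_mem_slicing hl)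
  exact ⟨_, Nat.le_add_right _ _, hi⟩

theorem eq_slice_of_seqAlive (v : ℕ → Bool) (π : MProof Γ) {l : MSlice} (hl : l ∈ π.slicing)
    (hv : ∀ i, l.Touches i → SeqAlive v Γ i) : l = π.slice v := by
  induction π generalizing l with
  | ax a => exact Finset.mem_singleton.1 hl
  | parr p ih =>
    exact ih hl fun i hi => (seqAlive_parr _ _ _ _ (p.lt_of_touches hl hi)).1 (hv i hi)
  | tens p q ihp ihq =>
    obtain ⟨l, hl₁, m, hm, rfl⟩ := Finset.mem_image₂.1 hl
    rw [slice,
      ← ihp hl₁ fun i hi => (seqAlive_tens_left _ _ _ _ _ (p.lt_of_touches hl₁ hi)).1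
        (hv _ (MSlice.touches_union.2 (.inl (MSlice.touches_reindex.2 ⟨i, hi, rfl⟩)))),
      ← ihq hm fun i hi => (seqAlive_tens_right _ _ _ _ _ (q.lt_of_touches hm hi)).1
        (hv _ (MSlice.touches_union.2 (.inr (MSlice.touches_reindex.2 ⟨i, hi, rfl⟩))))]
  | ex _ _ _ _ _ p ih =>
    obtain ⟨l, hl₁, rfl⟩ := Finset.mem_image.1 hl
    rw [slice, ← ih hl₁ fun i hi => (seqAlive_ex _ _ _ _ _ _ _).1
      (hv _ (MSlice.touches_reindex.2 ⟨i, hi, rfl⟩))]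
  | plus1 p ih =>
    exact ih hl fun i hi => (seqAlive_plus_left _ _ _ _ (p.lt_of_touches hl hi)).1 (hv i hi)
  | plus2 p ih =>
    obtain ⟨l, hl₁, rfl⟩ := Finset.mem_image.1 hl
    rw [slice, ← ih hl₁ fun i hi => (seqAlive_plus_right _ _ _ _ (p.lt_of_touches hl₁ hi)).1
      (hv _ (MSlice.touches_reindex.2 ⟨i, hi, rfl⟩))]
  | wth x p q ihp ihq =>
    rcases Finset.mem_union.1 hl with hl | hl
    · obtain ⟨l, hl₁, rfl⟩ := Finset.mem_image.1 hl
      have h := fun i hi => (seqAlive_wth_left _ _ _ _ _ (p.lt_of_touches hl₁ hi)).1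
        (hv _ (MSlice.touches_reindex.2 ⟨i, hi, rfl⟩))
      obtain ⟨i, hi, hT⟩ := p.exists_touches_last hl₁
      rw [slice, (h i hT).1 hi, if_neg Bool.false_ne_true, ← ihp hl₁ fun i hi => (h i hi).2]
    · obtain ⟨l, hl₁, rfl⟩ := Finset.mem_image.1 hl
      have h := fun i hi => (seqAlive_wth_right _ _ _ _ _ (q.lt_of_touches hl₁ hi)).1
        (hv _ (MSlice.touches_reindex.2 ⟨i, hi, rfl⟩))
      obtain ⟨i, hi, hT⟩ := q.exists_touches_last hl₁
      rw [slice, (h i hT).1 hi, if_pos rfl, ← ihq hl₁ fun i hi => (h i hi).2]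

theorem slicing_eq_iff_forall_slice_eq (hlab : (mseqLabels Γ).Nodup) (π ν : MProof Γ) :
    π.slicing = ν.slicing ↔ ∀ v, π.slice v = ν.slice v := by
  constructor
  · intro h v
    exact ν.eq_slice_of_seqAlive v (h ▸ π.slice_mem_slicing v)
      fun i hi => π.seqAlive_of_touches_slice v hi
  · intro h
    ext l
    constructor
    · intro hl
      obtain ⟨v, rfl⟩ := π.exists_slice_eq hlab hl
      exact h v ▸ ν.slice_mem_slicing v
    · intro hl
      obtain ⟨v, rfl⟩ := ν.exists_slice_eq hlab hl
      exact h v ▸ π.slice_mem_slicing v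

theorem mem_slice_iff (v : ℕ → Bool) (π : MProof Γ) (p : Sym2 ℕ) :
    p ∈ π.slice v ↔ (π.bdtAt p).eval v = true := by
  have hp : s(pmin p, pmax p) = p := by
    induction p using Sym2.ind with
    | _ a b =>
      rcases le_total a b with h | h
      · simp [pmin, pmax, h]
      · simp [pmin, pmax, h, Sym2.eq_swap]
  rw [bdtAt, ← mk_mem_slice_iff, hp]

end MProof

/-- **MALL⁻ proof equivalence via BDT slicings.**  Let `π` and `ν` be two MALL⁻ proofs of
the same one-sided sequent `Γ` (whose `&` occurrences carry distinct labels).  Then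
`π ∼ ν` — i.e. `𝒮(π) = 𝒮(ν)` — iff their BDT slicings are equivalent, i.e.
`B(π)[α,β] ∼ B(ν)[α,β]` for every unordered pair of atom occurrences of `Γ`. -/
theorem mall_proof_equiv_iff_bdt_slicing_equiv
    (Γ : List MFormula) (hlab : (mseqLabels Γ).Nodup)
    (π ν : MProof Γ) :
    π.slicing = ν.slicing ↔ ∀ p : Sym2 ℕ, BDT.Equiv (π.bdtAt p) (ν.bdtAt p) := by
  simp only [π.slicing_eq_iff_forall_slice_eq hlab ν, Finset.ext_iff, MProof.mem_slice_iff,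
    BDT.Equiv, Bool.coe_iff_coe]
  exact forall_comm
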